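/- arXiv:1611.04938 — 2 statements merged into one kernel-verified Lean document; each statement's English description precedes it below -/
import Mathlib

section
/- Let u : ℝ³ → ℝ be a smooth solution of the 3D Pavlov equation u_yy = u_tx + u_y u_xx − u_x u_xy. Let q₀, q₁ : ℝ³ → ℝ be smooth functions satisfying ∂_t q₀ = −u_y ∂_x q₀, ∂_y q₀ = −u_x ∂_x q₀, ∂_t q₁ = −u_x ∂_x q₀ − u_y ∂_x q₁, ∂_y q₁ = ∂_x q₀ − u_x ∂_x q₁, and suppose ∂_x q₀ is nowhere vanishing. Then the function ψ₋₁ := q₁ / ∂_x q₀ + y satisfies the linearized Pavlov equation ℓ_E(ψ₋₁) := ∂_y² ψ₋₁ − ∂_t∂_x ψ₋₁ − u_y ∂_x² ψ₋₁ + u_x ∂_x∂_y ψ₋₁ − u_xx ∂_y ψ₋₁ + u_xy ∂_x ψ₋₁ = 0 at every point of ℝ³. (ψ₋₁ is a nonlocal shadow of a symmetry of the Pavlov equation in its positive covering.) -/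
noncomputable section

/-- Partial derivative with respect to the first variable (`x`). -/
def Dx (f : ℝ → ℝ → ℝ → ℝ) (x y t : ℝ) : ℝ := deriv (fun x' => f x' y t) x

/-- Partial derivative with respect to the second variable (`y`). -/
def Dy (f : ℝ → ℝ → ℝ → ℝ) (x y t : ℝ) : ℝ := deriv (fun y' => f x y' t) y

/-- Partial derivative with respect to the third variable (`t`). -/
def Dt (f : ℝ → ℝ → ℝ → ℝ) (x y t : ℝ) : ℝ := deriv (fun t' => f x y t') t

/-- Smoothness of a function of three real variables `(x, y, t)`. -/
def Smooth3 (f : ℝ → ℝ → ℝ → ℝ) : Prop :=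
  ContDiff ℝ (⊤ : ℕ∞) (fun p : ℝ × ℝ × ℝ => f p.1 p.2.1 p.2.2)

/-- Linearization of the Pavlov equation `u_yy = u_tx + u_y u_xx - u_x u_xy` at a solution `u`. -/
def linPavlov (u φ : ℝ → ℝ → ℝ → ℝ) (x y t : ℝ) : ℝ :=
  Dy (Dy φ) x y t - Dt (Dx φ) x y t - Dy u x y t * Dx (Dx φ) x y t
    + Dx u x y t * Dx (Dy φ) x y t - Dx (Dx u) x y t * Dy φ x y t
    + Dx (Dy u) x y t * Dx φ x y t

theorem Smooth3.differentiableAt {f : ℝ → ℝ → ℝ → ℝ} (hf : Smooth3 f) (p : ℝ × ℝ × ℝ) :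
    DifferentiableAt ℝ (fun p : ℝ × ℝ × ℝ => f p.1 p.2.1 p.2.2) p :=
  (ContDiff.differentiable hf (by simp)).differentiableAt

theorem Smooth3.hasDerivAt_x {f : ℝ → ℝ → ℝ → ℝ} (hf : Smooth3 f) (x y t : ℝ) :
    HasDerivAt (fun x' => f x' y t)
      (fderiv ℝ (fun p : ℝ × ℝ × ℝ => f p.1 p.2.1 p.2.2) (x, y, t) (1, 0, 0)) x :=
  HasFDerivAt.comp_hasDerivAt (f := fun x' : ℝ => (x', y, t))
    (l := fun p : ℝ × ℝ × ℝ => f p.1 p.2.1 p.2.2) x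
    (hf.differentiableAt (x, y, t)).hasFDerivAt
    ((hasDerivAt_id x).prodMk ((hasDerivAt_const x y).prodMk (hasDerivAt_const x t)))

theorem Smooth3.hasDerivAt_y {f : ℝ → ℝ → ℝ → ℝ} (hf : Smooth3 f) (x y t : ℝ) :
    HasDerivAt (fun y' => f x y' t)
      (fderiv ℝ (fun p : ℝ × ℝ × ℝ => f p.1 p.2.1 p.2.2) (x, y, t) (0, 1, 0)) y :=
  HasFDerivAt.comp_hasDerivAt (f := fun y' : ℝ => (x, y', t))
    (l := fun p : ℝ × ℝ × ℝ => f p.1 p.2.1 p.2.2) y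
    (hf.differentiableAt (x, y, t)).hasFDerivAt
    ((hasDerivAt_const y x).prodMk ((hasDerivAt_id y).prodMk (hasDerivAt_const y t)))

theorem Smooth3.hasDerivAt_t {f : ℝ → ℝ → ℝ → ℝ} (hf : Smooth3 f) (x y t : ℝ) :
    HasDerivAt (fun t' => f x y t')
      (fderiv ℝ (fun p : ℝ × ℝ × ℝ => f p.1 p.2.1 p.2.2) (x, y, t) (0, 0, 1)) t :=
  HasFDerivAt.comp_hasDerivAt (f := fun t' : ℝ => (x, y, t'))
    (l := fun p : ℝ × ℝ × ℝ => f p.1 p.2.1 p.2.2) t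
    (hf.differentiableAt (x, y, t)).hasFDerivAt
    ((hasDerivAt_const t x).prodMk ((hasDerivAt_const t y).prodMk (hasDerivAt_id t)))

theorem Smooth3.hasDerivAt_Dx {f : ℝ → ℝ → ℝ → ℝ} (hf : Smooth3 f) (x y t : ℝ) :
    HasDerivAt (fun x' => f x' y t) (Dx f x y t) x :=
  (hf.hasDerivAt_x x y t).differentiableAt.hasDerivAt

theorem Smooth3.hasDerivAt_Dy {f : ℝ → ℝ → ℝ → ℝ} (hf : Smooth3 f) (x y t : ℝ) :
    HasDerivAt (fun y' => f x y' t) (Dy f x y t) y :=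
  (hf.hasDerivAt_y x y t).differentiableAt.hasDerivAt

theorem Smooth3.hasDerivAt_Dt {f : ℝ → ℝ → ℝ → ℝ} (hf : Smooth3 f) (x y t : ℝ) :
    HasDerivAt (fun t' => f x y t') (Dt f x y t) t :=
  (hf.hasDerivAt_t x y t).differentiableAt.hasDerivAt

theorem Smooth3.Dx_eq_fderiv {f : ℝ → ℝ → ℝ → ℝ} (hf : Smooth3 f) :
    (fun p : ℝ × ℝ × ℝ => Dx f p.1 p.2.1 p.2.2) =
      fun p => fderiv ℝ (fun p : ℝ × ℝ × ℝ => f p.1 p.2.1 p.2.2) p (1, 0, 0) :=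
  funext fun p => (hf.hasDerivAt_x p.1 p.2.1 p.2.2).deriv

theorem Smooth3.Dy_eq_fderiv {f : ℝ → ℝ → ℝ → ℝ} (hf : Smooth3 f) :
    (fun p : ℝ × ℝ × ℝ => Dy f p.1 p.2.1 p.2.2) =
      fun p => fderiv ℝ (fun p : ℝ × ℝ × ℝ => f p.1 p.2.1 p.2.2) p (0, 1, 0) :=
  funext fun p => (hf.hasDerivAt_y p.1 p.2.1 p.2.2).deriv

theorem Smooth3.Dt_eq_fderiv {f : ℝ → ℝ → ℝ → ℝ} (hf : Smooth3 f) :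
    (fun p : ℝ × ℝ × ℝ => Dt f p.1 p.2.1 p.2.2) =
      fun p => fderiv ℝ (fun p : ℝ × ℝ × ℝ => f p.1 p.2.1 p.2.2) p (0, 0, 1) :=
  funext fun p => (hf.hasDerivAt_t p.1 p.2.1 p.2.2).deriv

theorem Smooth3.contDiff_fderiv {f : ℝ → ℝ → ℝ → ℝ} (hf : Smooth3 f) :
    ContDiff ℝ (⊤ : ℕ∞) (fderiv ℝ (fun p : ℝ × ℝ × ℝ => f p.1 p.2.1 p.2.2)) :=
  ContDiff.fderiv_right hf (by simp)

theorem Smooth3.smooth3_Dx {f : ℝ → ℝ → ℝ → ℝ} (hf : Smooth3 f) : Smooth3 (Dx f) := by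
  rw [Smooth3, hf.Dx_eq_fderiv]
  exact hf.contDiff_fderiv.clm_apply contDiff_const

theorem Smooth3.smooth3_Dy {f : ℝ → ℝ → ℝ → ℝ} (hf : Smooth3 f) : Smooth3 (Dy f) := by
  rw [Smooth3, hf.Dy_eq_fderiv]
  exact hf.contDiff_fderiv.clm_apply contDiff_const

theorem Smooth3.smooth3_Dt {f : ℝ → ℝ → ℝ → ℝ} (hf : Smooth3 f) : Smooth3 (Dt f) := by
  rw [Smooth3, hf.Dt_eq_fderiv]
  exact hf.contDiff_fderiv.clm_apply contDiff_const

theorem Smooth3.fderiv_fderiv_comm {f : ℝ → ℝ → ℝ → ℝ} (hf : Smooth3 f)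
    (p v w : ℝ × ℝ × ℝ) :
    fderiv ℝ (fun p' => fderiv ℝ (fun p : ℝ × ℝ × ℝ => f p.1 p.2.1 p.2.2) p' v) p w =
      fderiv ℝ (fun p' => fderiv ℝ (fun p : ℝ × ℝ × ℝ => f p.1 p.2.1 p.2.2) p' w) p v := by
  have hd : DifferentiableAt ℝ (fderiv ℝ (fun p : ℝ × ℝ × ℝ => f p.1 p.2.1 p.2.2)) p :=
    (hf.contDiff_fderiv.differentiable (by simp)).differentiableAt
  have hs : IsSymmSndFDerivAt ℝ (fun p : ℝ × ℝ × ℝ => f p.1 p.2.1 p.2.2) p :=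
    (ContDiff.contDiffAt hf).isSymmSndFDerivAt (by
      rw [minSmoothness_of_isRCLikeNormedField]
      exact WithTop.coe_le_coe.2 (le_top : (2 : ℕ∞) ≤ ⊤))
  rw [fderiv_clm_apply hd (by fun_prop), fderiv_clm_apply hd (by fun_prop)]
  simpa using hs.eq w v

theorem Smooth3.Dy_Dx {f : ℝ → ℝ → ℝ → ℝ} (hf : Smooth3 f) (x y t : ℝ) :
    Dy (Dx f) x y t = Dx (Dy f) x y t := by
  refine (hf.smooth3_Dx.hasDerivAt_y x y t).deriv.trans
    (Eq.trans ?_ (hf.smooth3_Dy.hasDerivAt_x x y t).deriv.symm)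
  rw [hf.Dx_eq_fderiv, hf.Dy_eq_fderiv]
  exact hf.fderiv_fderiv_comm _ _ _

theorem Smooth3.Dt_Dx {f : ℝ → ℝ → ℝ → ℝ} (hf : Smooth3 f) (x y t : ℝ) :
    Dt (Dx f) x y t = Dx (Dt f) x y t := by
  refine (hf.smooth3_Dx.hasDerivAt_t x y t).deriv.trans
    (Eq.trans ?_ (hf.smooth3_Dt.hasDerivAt_x x y t).deriv.symm)
  rw [hf.Dx_eq_fderiv, hf.Dt_eq_fderiv]
  exact hf.fderiv_fderiv_comm _ _ _

/-- The nonlocal shadow `ψ₋₁ = q₁ / (q₀)_x + y` of the Pavlov equation in the positive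
covering. -/
theorem pavlov_nonlocal_shadow
    (u : ℝ → ℝ → ℝ → ℝ) (hu : Smooth3 u)
    (husol : ∀ x y t : ℝ, Dy (Dy u) x y t = Dt (Dx u) x y t + Dy u x y t * Dx (Dx u) x y t - Dx u x y t * Dx (Dy u) x y t)
    (q₀ q₁ : ℝ → ℝ → ℝ → ℝ) (hq₀ : Smooth3 q₀) (hq₁ : Smooth3 q₁)
    (hq₀t : ∀ x y t : ℝ, Dt q₀ x y t = -Dy u x y t * Dx q₀ x y t)
    (hq₀y : ∀ x y t : ℝ, Dy q₀ x y t = -Dx u x y t * Dx q₀ x y t)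
    (hq₁t : ∀ x y t : ℝ,
      Dt q₁ x y t = -Dx u x y t * Dx q₀ x y t - Dy u x y t * Dx q₁ x y t)
    (hq₁y : ∀ x y t : ℝ,
      Dy q₁ x y t = Dx q₀ x y t - Dx u x y t * Dx q₁ x y t)
    (hq₀x : ∀ x y t : ℝ, Dx q₀ x y t ≠ 0) :
    ∀ x y t : ℝ,
      linPavlov u (fun a b c => q₁ a b c / Dx q₀ a b c + b) x y t = 0 := by
  have hw : Smooth3 fun a b c => q₁ a b c / Dx q₀ a b c :=
    ContDiff.div hq₁ hq₀.smooth3_Dx fun p => hq₀x p.1 p.2.1 p.2.2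
  obtain ⟨w, hw_def⟩ : ∃ w : ℝ → ℝ → ℝ → ℝ, w = fun a b c => q₁ a b c / Dx q₀ a b c :=
    ⟨_, rfl⟩
  rw [← hw_def] at hw
  have hq₁w : q₁ = fun a b c => w a b c * Dx q₀ a b c := by
    funext a b c
    rw [hw_def]
    exact (div_mul_cancel₀ _ (hq₀x a b c)).symm
  have hq₁Dx (x y t : ℝ) :
      Dx q₁ x y t = Dx w x y t * Dx q₀ x y t + w x y t * Dx (Dx q₀) x y t := by
    conv_lhs => rw [hq₁w]
    exact ((hw.hasDerivAt_Dx x y t).mul (hq₀.smooth3_Dx.hasDerivAt_Dx x y t)).deriv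
  have hw_y : Dy w = fun x y t => 1 + Dx (Dx u) x y t * w x y t - Dx u x y t * Dx w x y t := by
    funext x y t
    have h₁ : Dy q₁ x y t = Dy w x y t * Dx q₀ x y t + w x y t * Dy (Dx q₀) x y t := by
      conv_lhs => rw [hq₁w]
      exact ((hw.hasDerivAt_Dy x y t).mul (hq₀.smooth3_Dx.hasDerivAt_Dy x y t)).deriv
    have h₂ : Dx (Dy q₀) x y t =
        -Dx (Dx u) x y t * Dx q₀ x y t + -Dx u x y t * Dx (Dx q₀) x y t := by
      rw [show Dy q₀ = fun x y t => -Dx u x y t * Dx q₀ x y t from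
        funext fun x => funext fun y => funext fun t => hq₀y x y t]
      exact ((hu.smooth3_Dx.hasDerivAt_Dx x y t).neg.mul (hq₀.smooth3_Dx.hasDerivAt_Dx x y t)).deriv
    rw [hq₁y, hq₀.Dy_Dx, h₂, hq₁Dx] at h₁
    apply mul_right_cancel₀ (hq₀x x y t)
    linear_combination -h₁
  have hw_t : Dt w = fun x y t =>
      -Dx u x y t + Dx (Dy u) x y t * w x y t - Dy u x y t * Dx w x y t := by
    funext x y t
    have h₁ : Dt q₁ x y t = Dt w x y t * Dx q₀ x y t + w x y t * Dt (Dx q₀) x y t := by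
      conv_lhs => rw [hq₁w]
      exact ((hw.hasDerivAt_Dt x y t).mul (hq₀.smooth3_Dx.hasDerivAt_Dt x y t)).deriv
    have h₂ : Dx (Dt q₀) x y t =
        -Dx (Dy u) x y t * Dx q₀ x y t + -Dy u x y t * Dx (Dx q₀) x y t := by
      rw [show Dt q₀ = fun x y t => -Dy u x y t * Dx q₀ x y t from
        funext fun x => funext fun y => funext fun t => hq₀t x y t]
      exact ((hu.smooth3_Dy.hasDerivAt_Dx x y t).neg.mul (hq₀.smooth3_Dx.hasDerivAt_Dx x y t)).deriv
    rw [hq₁t, hq₀.Dt_Dx, h₂, hq₁Dx] at h₁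
    apply mul_right_cancel₀ (hq₀x x y t)
    linear_combination -h₁
  intro x y t
  have hφ_x : Dx (fun a b c => q₁ a b c / Dx q₀ a b c + b) = Dx w := by
    funext x y t
    rw [hw_def]
    exact deriv_add_const _
  have hφ_y : Dy (fun a b c => q₁ a b c / Dx q₀ a b c + b) = fun x y t => Dy w x y t + 1 := by
    funext x y t
    have h := ((hw.hasDerivAt_Dy x y t).add (hasDerivAt_id y)).deriv
    rw [hw_def] at h ⊢
    exact h
  have hφ_yy : Dy (fun x y t => Dy w x y t + 1) x y t = Dy (Dy w) x y t := deriv_add_const _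
  have hφ_xy : Dx (fun x y t => Dy w x y t + 1) x y t = Dx (Dy w) x y t := deriv_add_const _
  have hw_yy : Dy (Dy w) x y t =
      Dy (Dx (Dx u)) x y t * w x y t + Dx (Dx u) x y t * Dy w x y t
        - (Dy (Dx u) x y t * Dx w x y t + Dx u x y t * Dy (Dx w) x y t) := by
    conv_lhs => rw [hw_y]
    exact ((((hu.smooth3_Dx.smooth3_Dx.hasDerivAt_Dy x y t).mul (hw.hasDerivAt_Dy x y t)).const_add 1).sub
      ((hu.smooth3_Dx.hasDerivAt_Dy x y t).mul (hw.smooth3_Dx.hasDerivAt_Dy x y t))).deriv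
  have hw_tx : Dx (Dt w) x y t =
      -Dx (Dx u) x y t + (Dx (Dx (Dy u)) x y t * w x y t + Dx (Dy u) x y t * Dx w x y t)
        - (Dx (Dy u) x y t * Dx w x y t + Dy u x y t * Dx (Dx w) x y t) := by
    rw [hw_t]
    exact (((hu.smooth3_Dx.hasDerivAt_Dx x y t).neg.add
      ((hu.smooth3_Dy.smooth3_Dx.hasDerivAt_Dx x y t).mul (hw.hasDerivAt_Dx x y t))).sub
      ((hu.smooth3_Dy.hasDerivAt_Dx x y t).mul (hw.smooth3_Dx.hasDerivAt_Dx x y t))).deriv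
  have hu_xxy : Dy (Dx (Dx u)) x y t = Dx (Dx (Dy u)) x y t := by
    rw [hu.smooth3_Dx.Dy_Dx, show Dy (Dx u) = Dx (Dy u) from
      funext fun x => funext fun y => funext fun t => hu.Dy_Dx x y t]
  rw [linPavlov, hφ_x, hφ_y, hφ_yy, hφ_xy, hw_yy, hw.Dt_Dx, hw_tx, hu_xxy, hu.Dy_Dx, hw.Dy_Dx]
  ring
end
end

section
/- Let u : ℝ³ → ℝ be a smooth solution of the universal hierarchy equation u_yy = u_t u_xy − u_y u_tx with u_y nowhere vanishing, and let q₁ : ℝ³ → ℝ be any smooth function satisfying ∂_y q₁ = u_t / u_y and ∂_x q₁ = 1 / u_y at every point. Then the function ψ₀ := 2 q₁ u_y − y u_t satisfies the linearized universal hierarchy equation ℓ_E(ψ₀) := ∂_y² ψ₀ − u_t ∂_x∂_y ψ₀ + u_y ∂_x∂_t ψ₀ − u_xy ∂_t ψ₀ + u_xt ∂_y ψ₀ = 0 at every point of ℝ³. (ψ₀ is a nonlocal shadow of a symmetry of the universal hierarchy equation in its positive covering.) -/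
noncomputable section

/-- Linearization of the universal hierarchy equation `u_yy = u_t u_xy - u_y u_tx`
at a solution `u`. -/
def linUHE (u φ : ℝ → ℝ → ℝ → ℝ) (x y t : ℝ) : ℝ :=
  Dy (Dy φ) x y t - Dt u x y t * Dx (Dy φ) x y t + Dy u x y t * Dt (Dx φ) x y t
    - Dx (Dy u) x y t * Dt φ x y t + Dt (Dx u) x y t * Dy φ x y t

/-- Derivative of a function of three real variables in the direction `v`. -/
def dirDeriv (v : ℝ × ℝ × ℝ) (f : ℝ → ℝ → ℝ → ℝ) (x y t : ℝ) : ℝ :=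
  fderiv ℝ (fun p : ℝ × ℝ × ℝ => f p.1 p.2.1 p.2.2) (x, y, t) v

namespace Smooth3

variable {f g : ℝ → ℝ → ℝ → ℝ}

theorem differentiable (hf : Smooth3 f) :
    Differentiable ℝ (fun p : ℝ × ℝ × ℝ => f p.1 p.2.1 p.2.2) :=
  ContDiff.differentiable hf (by simp)

theorem mul (hf : Smooth3 f) (hg : Smooth3 g) : Smooth3 (f * g) :=
  ContDiff.mul hf hg

theorem add (hf : Smooth3 f) (hg : Smooth3 g) : Smooth3 (f + g) :=
  ContDiff.add hf hg

theorem sub (hf : Smooth3 f) (hg : Smooth3 g) : Smooth3 (f - g) :=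
  ContDiff.sub hf hg

theorem directional (hf : Smooth3 f) (v : ℝ × ℝ × ℝ) : Smooth3 (dirDeriv v f) :=
  (ContDiff.fderiv_right (m := ((⊤ : ℕ∞) : WithTop ℕ∞)) hf (by simp)).clm_apply contDiff_const

theorem dirDeriv_mul (hf : Smooth3 f) (hg : Smooth3 g) (v : ℝ × ℝ × ℝ) :
    dirDeriv v (f * g) = dirDeriv v f * g + f * dirDeriv v g := by
  funext x y t
  have h := ((hf.differentiable (x, y, t)).hasFDerivAt.mul
    (hg.differentiable (x, y, t)).hasFDerivAt).fderiv
  refine (congrArg (fun L => L v) h).trans ?_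
  simp [dirDeriv]
  ring

theorem dirDeriv_add (hf : Smooth3 f) (hg : Smooth3 g) (v : ℝ × ℝ × ℝ) :
    dirDeriv v (f + g) = dirDeriv v f + dirDeriv v g := by
  funext x y t
  exact congrArg (fun L => L v) ((hf.differentiable (x, y, t)).hasFDerivAt.add
    (hg.differentiable (x, y, t)).hasFDerivAt).fderiv

theorem dirDeriv_sub (hf : Smooth3 f) (hg : Smooth3 g) (v : ℝ × ℝ × ℝ) :
    dirDeriv v (f - g) = dirDeriv v f - dirDeriv v g := by
  funext x y t
  exact congrArg (fun L => L v) ((hf.differentiable (x, y, t)).hasFDerivAt.sub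
    (hg.differentiable (x, y, t)).hasFDerivAt).fderiv

theorem dirDeriv_dirDeriv (hf : Smooth3 f) (v w : ℝ × ℝ × ℝ) (x y t : ℝ) :
    dirDeriv v (dirDeriv w f) x y t =
      fderiv ℝ (fderiv ℝ (fun p : ℝ × ℝ × ℝ => f p.1 p.2.1 p.2.2)) (x, y, t) v w := by
  have h : Differentiable ℝ (fderiv ℝ (fun p : ℝ × ℝ × ℝ => f p.1 p.2.1 p.2.2)) :=
    (ContDiff.fderiv_right (m := ((⊤ : ℕ∞) : WithTop ℕ∞)) hf (by simp)).differentiable (by simp)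
  have h' := ((h (x, y, t)).hasFDerivAt.clm_apply (hasFDerivAt_const w (x, y, t))).fderiv
  refine (congrArg (fun L => L v) h').trans ?_
  simp

theorem dirDeriv_comm (hf : Smooth3 f) (v w : ℝ × ℝ × ℝ) :
    dirDeriv v (dirDeriv w f) = dirDeriv w (dirDeriv v f) := by
  funext x y t
  rw [hf.dirDeriv_dirDeriv, hf.dirDeriv_dirDeriv]
  exact (ContDiff.contDiffAt hf).isSymmSndFDerivAt
    (by
      rw [minSmoothness_of_isRCLikeNormedField]
      exact WithTop.coe_le_coe.2 (le_top : (2 : ℕ∞) ≤ ⊤)) v w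

theorem Dx_eq (hf : Smooth3 f) : Dx f = dirDeriv (1, 0, 0) f := by
  funext x y t
  exact ((hf.differentiable (x, y, t)).hasFDerivAt.comp_hasDerivAt x
    ((hasDerivAt_id x).prodMk (hasDerivAt_const x (y, t)))).deriv

theorem Dy_eq (hf : Smooth3 f) : Dy f = dirDeriv (0, 1, 0) f := by
  funext x y t
  exact ((hf.differentiable (x, y, t)).hasFDerivAt.comp_hasDerivAt y
    ((hasDerivAt_const y x).prodMk ((hasDerivAt_id y).prodMk (hasDerivAt_const y t)))).deriv

theorem Dt_eq (hf : Smooth3 f) : Dt f = dirDeriv (0, 0, 1) f := by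
  funext x y t
  exact ((hf.differentiable (x, y, t)).hasFDerivAt.comp_hasDerivAt t
    ((hasDerivAt_const t x).prodMk ((hasDerivAt_const t y).prodMk (hasDerivAt_id t)))).deriv

theorem linUHE_eq {u φ : ℝ → ℝ → ℝ → ℝ} (hu : Smooth3 u) (hφ : Smooth3 φ) :
    linUHE u φ =
      dirDeriv (0, 1, 0) (dirDeriv (0, 1, 0) φ)
        - dirDeriv (0, 0, 1) u * dirDeriv (1, 0, 0) (dirDeriv (0, 1, 0) φ)
        + dirDeriv (0, 1, 0) u * dirDeriv (0, 0, 1) (dirDeriv (1, 0, 0) φ)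
        - dirDeriv (1, 0, 0) (dirDeriv (0, 1, 0) u) * dirDeriv (0, 0, 1) φ
        + dirDeriv (0, 0, 1) (dirDeriv (1, 0, 0) u) *
          dirDeriv (0, 1, 0) φ := by
  funext x y t
  simp only [linUHE, hφ.Dx_eq, hφ.Dy_eq, hφ.Dt_eq, hu.Dx_eq, hu.Dy_eq, hu.Dt_eq,
    (hφ.directional _).Dx_eq, (hφ.directional _).Dy_eq, (hφ.directional _).Dt_eq,
    (hu.directional _).Dx_eq, (hu.directional _).Dt_eq, Pi.add_apply, Pi.sub_apply, Pi.mul_apply]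

/-- Directional derivatives of a solution are symmetries: translation invariance of the
universal hierarchy equation. -/
theorem linUHE_dirDeriv {u : ℝ → ℝ → ℝ → ℝ} (hu : Smooth3 u)
    (husol : Dy (Dy u) = Dt u * Dx (Dy u) - Dy u * Dt (Dx u)) (v : ℝ × ℝ × ℝ) :
    linUHE u (dirDeriv v u) = 0 := by
  have h := congrArg (dirDeriv v) husol
  simp only [hu.Dx_eq, hu.Dy_eq, hu.Dt_eq, (hu.directional _).Dx_eq, (hu.directional _).Dy_eq,
    (hu.directional _).Dt_eq] at h
  rw [((hu.directional _).mul ((hu.directional _).directional _)).dirDeriv_sub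
      ((hu.directional _).mul ((hu.directional _).directional _)),
    (hu.directional _).dirDeriv_mul ((hu.directional _).directional _),
    (hu.directional _).dirDeriv_mul ((hu.directional _).directional _)] at h
  simp only [(hu.directional _).dirDeriv_comm v, hu.dirDeriv_comm v] at h
  rw [linUHE_eq hu (hu.directional v), h]
  ring

/-- Second-order Leibniz rule for directional derivatives. -/
theorem dirDeriv_dirDeriv_mul (hf : Smooth3 f) (hg : Smooth3 g) (v w : ℝ × ℝ × ℝ) :
    dirDeriv v (dirDeriv w (f * g)) =
      dirDeriv v (dirDeriv w f) * g + dirDeriv w f * dirDeriv v g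
        + dirDeriv v f * dirDeriv w g
        + f * dirDeriv v (dirDeriv w g) := by
  rw [hf.dirDeriv_mul hg, ((hf.directional w).mul hg).dirDeriv_add (hf.mul (hg.directional w)),
    (hf.directional w).dirDeriv_mul hg, hf.dirDeriv_mul (hg.directional w)]
  ring

theorem linUHE_add {u : ℝ → ℝ → ℝ → ℝ} (hu : Smooth3 u) (hf : Smooth3 f) (hg : Smooth3 g) :
    linUHE u (f + g) = linUHE u f + linUHE u g := by
  rw [linUHE_eq hu (hf.add hg), linUHE_eq hu hf, linUHE_eq hu hg]
  simp only [hf.dirDeriv_add hg, (hf.directional _).dirDeriv_add (hg.directional _)]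
  ring

theorem linUHE_sub {u : ℝ → ℝ → ℝ → ℝ} (hu : Smooth3 u) (hf : Smooth3 f) (hg : Smooth3 g) :
    linUHE u (f - g) = linUHE u f - linUHE u g := by
  rw [linUHE_eq hu (hf.sub hg), linUHE_eq hu hf, linUHE_eq hu hg]
  simp only [hf.dirDeriv_sub hg, (hf.directional _).dirDeriv_sub (hg.directional _)]
  ring

theorem linUHE_mul {u : ℝ → ℝ → ℝ → ℝ} (hu : Smooth3 u) (hf : Smooth3 f) (hg : Smooth3 g) :
    linUHE u (f * g) = f * linUHE u g + g * linUHE u f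
      + 2 * dirDeriv (0, 1, 0) f * dirDeriv (0, 1, 0) g
      - dirDeriv (0, 0, 1) u *
        (dirDeriv (1, 0, 0) f * dirDeriv (0, 1, 0) g
          + dirDeriv (0, 1, 0) f * dirDeriv (1, 0, 0) g)
      + dirDeriv (0, 1, 0) u *
        (dirDeriv (1, 0, 0) f * dirDeriv (0, 0, 1) g
          + dirDeriv (0, 0, 1) f * dirDeriv (1, 0, 0) g) := by
  rw [linUHE_eq hu (hf.mul hg), linUHE_eq hu hf, linUHE_eq hu hg]
  simp only [hf.dirDeriv_dirDeriv_mul hg]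
  simp only [hf.dirDeriv_mul hg]
  ring

end Smooth3

theorem smooth3_snd : Smooth3 (fun _ b _ => b) :=
  contDiff_fst.comp contDiff_snd

theorem dirDeriv_const (v : ℝ × ℝ × ℝ) (c : ℝ) : dirDeriv v (fun _ _ _ => c) = 0 := by
  funext x y t
  simp [dirDeriv]

theorem dirDeriv_snd (v : ℝ × ℝ × ℝ) :
    dirDeriv v (fun _ b _ => b) = fun _ _ _ => v.2.1 := by
  funext x y t
  exact congrArg (fun L => L v)
    (hasFDerivAt_fst.comp (x, y, t) (hasFDerivAt_snd (𝕜 := ℝ) (p := (x, y, t)))).fderiv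

/-- The nonlocal shadow `ψ₀ = 2 q₁ u_y - y u_t` of the universal hierarchy equation in the
positive covering. -/
theorem uhe_nonlocal_shadow
    (u : ℝ → ℝ → ℝ → ℝ) (hu : Smooth3 u)
    (husol : ∀ x y t : ℝ, Dy (Dy u) x y t = Dt u x y t * Dx (Dy u) x y t - Dy u x y t * Dt (Dx u) x y t)
    (huy : ∀ x y t : ℝ, Dy u x y t ≠ 0)
    (q₁ : ℝ → ℝ → ℝ → ℝ) (hq₁ : Smooth3 q₁)
    (hq₁y : ∀ x y t : ℝ, Dy q₁ x y t = Dt u x y t / Dy u x y t)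
    (hq₁x : ∀ x y t : ℝ, Dx q₁ x y t = 1 / Dy u x y t) :
    ∀ x y t : ℝ,
      linUHE u (fun a b c => 2 * q₁ a b c * Dy u a b c - b * Dt u a b c) x y t = 0 := by
  have hsol : Dy (Dy u) = Dt u * Dx (Dy u) - Dy u * Dt (Dx u) := by
    funext x y t
    exact husol x y t
  have hqx : dirDeriv (1, 0, 0) q₁ * dirDeriv (0, 1, 0) u = fun _ _ _ => 1 := by
    funext x y t
    have h := hq₁x x y t
    rw [eq_div_iff (huy x y t), hq₁.Dx_eq, hu.Dy_eq] at h
    exact h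
  have hqy : dirDeriv (0, 1, 0) q₁ * dirDeriv (0, 1, 0) u = dirDeriv (0, 0, 1) u := by
    funext x y t
    have h := hq₁y x y t
    rw [eq_div_iff (huy x y t), hq₁.Dy_eq, hu.Dy_eq, hu.Dt_eq] at h
    exact h
  have hψ : (fun a b c => 2 * q₁ a b c * Dy u a b c - b * Dt u a b c) =
      q₁ * dirDeriv (0, 1, 0) u + q₁ * dirDeriv (0, 1, 0) u
        - (fun _ b _ => b) * dirDeriv (0, 0, 1) u := by
    funext a b c
    simp only [hu.Dy_eq, hu.Dt_eq, Pi.add_apply, Pi.sub_apply, Pi.mul_apply]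
    ring
  have hp := hu.directional (0, 1, 0)
  have hr := hu.directional (0, 0, 1)
  have hqp := hq₁.mul hp
  have hqxy := congrArg (dirDeriv (0, 1, 0)) hqx
  have hqxt := congrArg (dirDeriv (0, 0, 1)) hqx
  have hqyy := congrArg (dirDeriv (0, 1, 0)) hqy
  rw [(hq₁.directional _).dirDeriv_mul hp, dirDeriv_const] at hqxy hqxt
  rw [(hq₁.directional _).dirDeriv_mul hp] at hqyy
  intro x y t
  rw [hψ, hu.linUHE_sub (hqp.add hqp) (smooth3_snd.mul hr), hu.linUHE_add hqp hqp,
    hu.linUHE_mul hq₁ hp, hu.linUHE_mul smooth3_snd hr, hu.linUHE_dirDeriv hsol,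
    hu.linUHE_dirDeriv hsol, hu.linUHE_eq hq₁, hu.linUHE_eq smooth3_snd]
  rw [hq₁.dirDeriv_comm (0, 1, 0) (1, 0, 0)] at hqxy
  rw [hu.dirDeriv_comm (0, 1, 0) (0, 0, 1)] at hqyy
  have e := husol x y t
  simp only [hu.Dx_eq, hu.Dy_eq, hu.Dt_eq, hp.Dx_eq, hp.Dy_eq, (hu.directional _).Dt_eq] at e
  have hxy := congrFun (congrFun (congrFun hqxy x) y) t
  have hxt := congrFun (congrFun (congrFun hqxt x) y) t
  have hyy := congrFun (congrFun (congrFun hqyy x) y) t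
  simp only [dirDeriv_snd, dirDeriv_const, hu.dirDeriv_comm (0, 1, 0) (0, 0, 1),
    hu.dirDeriv_comm (1, 0, 0) (0, 0, 1), Pi.add_apply, Pi.sub_apply, Pi.mul_apply,
    Pi.ofNat_apply] at hxy hxt hyy ⊢
  linear_combination 2 * hyy - 2 * dirDeriv (0, 0, 1) u x y t * hxy
    + 2 * dirDeriv (0, 1, 0) u x y t * hxt + 2 * dirDeriv (0, 1, 0) q₁ x y t * e
end
end
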